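/- Let σ ∈ ℕ with σ ≥ 1. For every x ∈ ℝ, the mixed uniform-logarithmic quantizer Q satisfies |Q(x)| ≤ (1 + 0.5/10^(σ−1))·|x|. -/

import Mathlib

/-- Base-10 scaling factor of the mixed uniform-logarithmic quantizer (MULQ):
`S(x) = 10^(σ - ⌊log₁₀ |x|⌋ - 1)`. -/
noncomputable def mulqS (σ : ℕ) (x : ℝ) : ℝ :=
  (10 : ℝ) ^ ((σ : ℤ) - ⌊Real.logb 10 |x|⌋ - 1)

/-- The mixed uniform-logarithmic quantizer: `Q(x) = (1/S(x)) ⬝ round (S(x)·x)`, `Q(0) = 0`. -/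
noncomputable def mulqQ (σ : ℕ) (x : ℝ) : ℝ :=
  if x = 0 then 0 else (round (mulqS σ x * x) : ℤ) / mulqS σ x

lemma mulqS_pos (σ : ℕ) (x : ℝ) : 0 < mulqS σ x :=
  zpow_pos (by norm_num) _

/-- A nonzero scaled input has magnitude at least `10 ^ (σ - 1)`. -/
lemma pow_le_mulqS_mul_abs {σ : ℕ} (hσ : 1 ≤ σ) {x : ℝ} (hx : x ≠ 0) :
    (10 : ℝ) ^ (σ - 1) ≤ mulqS σ x * |x| := by
  have hfloor : (10 : ℝ) ^ ⌊Real.logb 10 |x|⌋ ≤ |x| := by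
    rw [← Real.rpow_intCast, ← Real.le_logb_iff_rpow_le (by norm_num) (abs_pos.mpr hx)]
    exact Int.floor_le _
  calc (10 : ℝ) ^ (σ - 1) = mulqS σ x * 10 ^ ⌊Real.logb 10 |x|⌋ := by
        rw [mulqS, ← zpow_add₀ (by norm_num), ← zpow_natCast]
        congr 1
        lia
    _ ≤ mulqS σ x * |x| := mul_le_mul_of_nonneg_left hfloor (mulqS_pos σ x).le

lemma abs_round_le_abs_add_half (t : ℝ) : |(round t : ℝ)| ≤ |t| + 1 / 2 := by
  have h := abs_sub_abs_le_abs_sub (round t : ℝ) t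
  rw [abs_sub_comm] at h
  linarith [abs_sub_round t]

/-- Bound (A3): `|Q(x)| ≤ (1 + 0.5/10^(σ−1))·|x|`. -/
theorem mulq_gain_bound (σ : ℕ) (hσ : 1 ≤ σ) (x : ℝ) :
    |mulqQ σ x| ≤ (1 + 0.5 / 10 ^ (σ - 1)) * |x| := by
  rcases eq_or_ne x 0 with rfl | hx
  · simp [mulqQ]
  have hS := mulqS_pos σ x
  have hone : 1 ≤ mulqS σ x * |x| / 10 ^ (σ - 1) :=
    (one_le_div (by positivity)).mpr (pow_le_mulqS_mul_abs hσ hx)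
  have hround := abs_round_le_abs_add_half (mulqS σ x * x)
  rw [abs_mul, abs_of_pos hS] at hround
  rw [mulqQ, if_neg hx, abs_div, abs_of_pos hS, div_le_iff₀ hS]
  calc |(round (mulqS σ x * x) : ℝ)|
      ≤ mulqS σ x * |x| + 0.5 * (mulqS σ x * |x| / 10 ^ (σ - 1)) := by linarith
    _ = (1 + 0.5 / 10 ^ (σ - 1)) * |x| * mulqS σ x := by ring
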